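/- arXiv:2108.06750 — 2 statements merged into one kernel-verified Lean document; each statement's English description precedes it below -/
import Mathlib

section
/- Let Δ be a simplicial complex on {1,…,r} with facets F_1,…,F_t, and suppose there exist n ≥ 1, i ≥ 0 and α ∈ ℕ^r with H_m^i(R/I_Δ^{(n)})_α ≠ 0 and (after renumbering) F(Δ_α(I_Δ^{(n)})) = {F_1,…,F_s}, where 1 ≤ s ≤ t. For m ≥ 1 let P_m ⊆ ℝ^r be the polyhedron defined by ∑_{i∉F_j} x_i ≤ m−1 for j = 1,…,s, ∑_{i∉F_j} x_i ≥ m for j = s+1,…,t, and x ≥ 0. Then for every m ≥ 1 and every β ∈ P_m ∩ ℕ^r, one has Δ_β(I_Δ^{(m)}) = ⟨F_1,…,F_s⟩ = Δ_α(I_Δ^{(n)}) and H_m^i(R/I_Δ^{(m)})_β ≠ 0. -/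
open MvPolynomial Finset Filter

noncomputable section

/-- A family of potential faces (subsets of the vertex set `ι`). -/
abbrev FaceSet (ι : Type*) := Set (Finset ι)

/-- A face set is a simplicial complex if it is closed under taking subsets. -/
def IsSimplicialComplex {ι : Type*} (Δ : FaceSet ι) : Prop :=
  ∀ σ ∈ Δ, ∀ τ : Finset ι, τ ⊆ σ → τ ∈ Δ

/-- The facets (maximal faces) of a face set. -/
def facets {ι : Type*} (Δ : FaceSet ι) : FaceSet ι :=
  {σ | σ ∈ Δ ∧ ∀ τ ∈ Δ, σ ⊆ τ → σ = τ}

/-- The Stanley–Reisner ideal of a simplicial complex: it is generated by the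
square-free monomials corresponding to non-faces. -/
def srIdeal (K : Type*) [Field K] {ι : Type*} (Δ : FaceSet ι) :
    Ideal (MvPolynomial ι K) :=
  Ideal.span {p | ∃ τ : Finset ι, τ ∉ Δ ∧ p = ∏ i ∈ τ, X i}

/-- The `n`-th symbolic power `I^{(n)} = ⋂_{p ∈ Min(I)} (Iⁿ R_p ∩ R)`. -/
def symbolicPower {R : Type*} [CommRing R] (I : Ideal R) (n : ℕ) : Ideal R :=
  ⨅ (p : Ideal R) (hp : p ∈ I.minimalPrimes),
    letI : p.IsPrime := hp.1.1
    (Ideal.map (algebraMap R (Localization.AtPrime p)) (I ^ n)).comap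
      (algebraMap R (Localization.AtPrime p))

/-- The simplicial boundary operator on the space of chains (finitely supported
`K`-valued functions on finite subsets of `ι`), using the orientation coming
from the linear order of `ι`; a set of cardinality `d` is viewed as a
`(d-1)`-dimensional simplex, the empty set accounting for the augmentation. -/
def bdry (K : Type*) [Field K] {ι : Type*} [LinearOrder ι] :
    (Finset ι →₀ K) →ₗ[K] (Finset ι →₀ K) :=
  Finsupp.lsum K fun σ => LinearMap.toSpanSingleton K _
    (∑ v ∈ σ, ((-1 : K) ^ (σ.filter fun w => w < v).card) • Finsupp.single (σ.erase v) (1 : K))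

/-- The subspace of chains supported on the faces of `Δ` of cardinality `d`. -/
def cardFaces (K : Type*) [Field K] {ι : Type*} (Δ : FaceSet ι) (d : ℕ) :
    Submodule K (Finset ι →₀ K) :=
  Submodule.span K {f | ∃ σ ∈ Δ, σ.card = d ∧ f = Finsupp.single σ (1 : K)}

/-- `H̃ⱼ(Δ; K) ≠ 0`: there is a cycle of cardinality-degree `j + 1` which is not
a boundary of a chain of `Δ`. -/
def HasNontrivialReducedHomology (K : Type*) [Field K] {ι : Type*} [LinearOrder ι]
    (Δ : FaceSet ι) (j : ℤ) : Prop :=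
  ∃ d : ℕ, (d : ℤ) = j + 1 ∧
    ∃ z ∈ cardFaces K Δ d, bdry K z = 0 ∧ z ∉ ⇑(bdry K) '' ↑(cardFaces K Δ (d + 1))

/-- `G_α = {i : α_i < 0}`. -/
def negSupport {ι : Type*} [Fintype ι] (α : ι → ℤ) : Finset ι :=
  Finset.univ.filter fun i => α i < 0

/-- The degree complex `Δ_α(I) = {F ⊆ [r] \ G_α : x^α ∉ I·R_F}` of Takayama, where
`x^α ∈ I·R_F` is expressed by saturation: `x^{α⁺}·(∏_{i ∈ F ∪ G_α} x_i)^m ∈ I` for some `m`. -/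
def degreeComplex (K : Type*) [Field K] {ι : Type*} [Fintype ι] [LinearOrder ι]
    (I : Ideal (MvPolynomial ι K)) (α : ι → ℤ) : FaceSet ι :=
  {F | (∀ i ∈ F, 0 ≤ α i) ∧
    ¬∃ m : ℕ,
      monomial (Finsupp.equivFunOnFinite.symm fun i => (α i).toNat) (1 : K) *
        (∏ i ∈ F ∪ negSupport α, X i) ^ m ∈ I}

/-- Nonvanishing of the graded piece `H_𝔪^i(R/I)_α` of local cohomology of a monomial
quotient, expressed via Takayama's formula
`dim_K H_𝔪^i(R/I)_α = dim_K H̃_{i-|G_α|-1}(Δ_α(I); K)`. -/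
def lcNonzero (K : Type*) [Field K] {ι : Type*} [Fintype ι] [LinearOrder ι]
    (I : Ideal (MvPolynomial ι K)) (i : ℕ) (α : ι → ℤ) : Prop :=
  HasNontrivialReducedHomology K (degreeComplex K I α) ((i : ℤ) - (negSupport α).card - 1)

/-- The `a_i`-invariant `a_i(R/I) = max{t : H_𝔪^i(R/I)_t ≠ 0}` of a monomial quotient
(`H_𝔪^i(R/I)_t = ⊕_{|α| = t} H_𝔪^i(R/I)_α`). -/
def aInv (K : Type*) [Field K] {ι : Type*} [Fintype ι] [LinearOrder ι]
    (I : Ideal (MvPolynomial ι K)) (i : ℕ) : ℤ :=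
  sSup {z : ℤ | ∃ α : ι → ℤ, lcNonzero K I i α ∧ z = ∑ j, α j}

/-- The Castelnuovo–Mumford regularity `reg(R/I) = max_i (a_i(R/I) + i)` of a
monomial quotient. -/
def regQuot (K : Type*) [Field K] {ι : Type*} [Fintype ι] [LinearOrder ι]
    (I : Ideal (MvPolynomial ι K)) : ℤ :=
  sSup {z : ℤ | ∃ (i : ℕ) (α : ι → ℤ), lcNonzero K I i α ∧ z = (∑ j, α j) + i}

/-- The Castelnuovo–Mumford regularity of a (monomial) ideal: `reg(I) = reg(R/I) + 1`. -/
def reg (K : Type*) [Field K] {ι : Type*} [Fintype ι] [LinearOrder ι]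
    (I : Ideal (MvPolynomial ι K)) : ℤ :=
  regQuot K I + 1

/-- The depth `min{i : H_𝔪^i(R/I) ≠ 0}` of a monomial quotient. -/
def depthQuot (K : Type*) [Field K] {ι : Type*} [Fintype ι] [LinearOrder ι]
    (I : Ideal (MvPolynomial ι K)) : ℕ :=
  sInf {i : ℕ | ∃ α : ι → ℤ, lcNonzero K I i α}

/-- The projective dimension `pd(R/I) = r - depth(R/I)` (Auslander–Buchsbaum). -/
def pdQuot (K : Type*) [Field K] {ι : Type*} [Fintype ι] [LinearOrder ι]
    (I : Ideal (MvPolynomial ι K)) : ℤ :=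
  (Fintype.card ι : ℤ) - depthQuot K I

end
/-- The polyhedron `P_m` in `ℝ^r` given by `∑_{i ∉ F_j} x_i ≤ m − 1` for `j < s`,
`∑_{i ∉ F_j} x_i ≥ m` for `s ≤ j < t`, and `x ≥ 0`. -/
def polyP {r t : ℕ} (F : Fin t → Finset (Fin r)) (s m : ℕ) : Set (Fin r → ℝ) :=
  {x | (∀ i, 0 ≤ x i) ∧ ∀ j : Fin t,
    ((j : ℕ) < s → ∑ i ∈ (F j)ᶜ, x i ≤ (m : ℝ) - 1) ∧
    (s ≤ (j : ℕ) → (m : ℝ) ≤ ∑ i ∈ (F j)ᶜ, x i)}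

/-- The prime ideal `(x_i : i ∉ G)` attached to a set of vertices `G`. -/
noncomputable def facePrime (K : Type*) [Field K] {ι : Type*} (G : Finset ι) : Ideal (MvPolynomial ι K) :=
  Ideal.span (X '' {i | i ∉ G})

section

variable {K : Type*} [Field K] {ι : Type*}

lemma X_mem_facePrime {G : Finset ι} {i : ι} (hi : i ∉ G) :
    (X i : MvPolynomial ι K) ∈ facePrime K G :=
  Ideal.subset_span ⟨i, hi, rfl⟩

lemma mem_facePrime_iff {G : Finset ι} {f : MvPolynomial ι K} :
    f ∈ facePrime K G ↔ ∀ b ∈ f.support, ∃ i ∉ G, b i ≠ 0 :=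
  mem_ideal_span_X_image

lemma X_mem_facePrime_iff {G : Finset ι} {i : ι} :
    (X i : MvPolynomial ι K) ∈ facePrime K G ↔ i ∉ G := by
  classical
  refine ⟨fun h hi => ?_, X_mem_facePrime⟩
  obtain ⟨j, hj, hne⟩ := mem_facePrime_iff.1 h (Finsupp.single i 1) (by simp [support_X])
  refine hne (Finsupp.single_eq_of_ne ?_)
  rintro rfl
  exact hj hi

lemma facePrime_le_facePrime_iff {G H : Finset ι} :
    facePrime K H ≤ facePrime K G ↔ G ⊆ H := by
  refine ⟨fun h i hi => ?_, fun h => Ideal.span_mono <| Set.image_mono fun i hi hiG => hi (h hiG)⟩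
  by_contra hiH
  exact X_mem_facePrime_iff.1 (h (X_mem_facePrime (K := K) hiH)) hi

instance isPrime_facePrime (G : Finset ι) : (facePrime K G).IsPrime := by
  classical
  let ψ : MvPolynomial ι K →ₐ[K] MvPolynomial ι K := aeval fun i => if i ∈ G then X i else 0
  have hsub : ∀ f, f - ψ f ∈ facePrime K G := by
    intro f
    induction f using MvPolynomial.induction_on with
    | C a => simp [ψ]
    | add p q hp hq =>
      rw [map_add, add_sub_add_comm]
      exact add_mem hp hq
    | mul_X p i hp =>
      have h : p * X i - ψ (p * X i) = (p - ψ p) * X i + ψ p * (X i - ψ (X i)) := by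
        rw [map_mul]
        ring
      rw [h]
      refine add_mem (Ideal.mul_mem_right _ _ hp) (Ideal.mul_mem_left _ _ ?_)
      by_cases hi : i ∈ G
      · simp [ψ, hi]
      · simpa [ψ, hi] using X_mem_facePrime hi
  have hker : facePrime K G = RingHom.ker ψ := by
    refine le_antisymm (Ideal.span_le.2 ?_) fun f hf => ?_
    · rintro _ ⟨i, hi, rfl⟩
      have hi : i ∉ G := hi
      simp [ψ, RingHom.mem_ker, hi]
    · simpa [(RingHom.mem_ker).1 hf] using hsub f
  rw [hker]
  exact RingHom.ker_isPrime _

lemma srIdeal_le_facePrime {Δ : FaceSet ι} (hΔ : IsSimplicialComplex Δ) {G : Finset ι}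
    (hG : G ∈ Δ) : srIdeal K Δ ≤ facePrime K G := by
  refine Ideal.span_le.2 ?_
  rintro _ ⟨τ, hτ, rfl⟩
  obtain ⟨i, hiτ, hiG⟩ := Finset.not_subset.1 fun h => hτ (hΔ G hG τ h)
  exact Ideal.mem_of_dvd _ (Finset.dvd_prod_of_mem _ hiτ) (X_mem_facePrime hiG)

lemma exists_mem_facets_of_mem [Finite ι] {Δ : FaceSet ι} {τ : Finset ι} (hτ : τ ∈ Δ) :
    ∃ G ∈ facets Δ, τ ⊆ G := by
  obtain ⟨G, hle, hG⟩ := Set.Finite.exists_le_maximal (Set.toFinite Δ) hτ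
  exact ⟨G, ⟨hG.prop, fun σ hσ h => hG.eq_of_le hσ h⟩, hle⟩

lemma exists_facePrime_le [Finite ι] {Δ : FaceSet ι} {p : Ideal (MvPolynomial ι K)}
    (hp : p.IsPrime) (h : srIdeal K Δ ≤ p) : ∃ G ∈ facets Δ, facePrime K G ≤ p := by
  classical
  have := Fintype.ofFinite ι
  let σ : Finset ι := Finset.univ.filter fun i => (X i : MvPolynomial ι K) ∉ p
  have hσ : σ ∈ Δ := by
    by_contra hσ
    obtain ⟨i, hi, hip⟩ := (hp.prod_mem_iff).1 (h (Ideal.subset_span ⟨σ, hσ, rfl⟩))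
    exact (Finset.mem_filter.1 hi).2 hip
  obtain ⟨G, hG, hσG⟩ := exists_mem_facets_of_mem hσ
  refine ⟨G, hG, Ideal.span_le.2 ?_⟩
  rintro _ ⟨i, hi, rfl⟩
  by_contra hip
  exact hi (hσG (by simpa [σ] using hip))

/-- The minimal primes of a Stanley–Reisner ideal are the primes of the facets. -/
lemma minimalPrimes_srIdeal [Finite ι] {Δ : FaceSet ι} (hΔ : IsSimplicialComplex Δ) :
    (srIdeal K Δ).minimalPrimes = facePrime K '' facets Δ := by
  ext p
  constructor
  · intro hp
    obtain ⟨G, hG, hle⟩ := exists_facePrime_le hp.1.1 hp.1.2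
    exact ⟨G, hG, le_antisymm hle
      (hp.2 ⟨isPrime_facePrime G, srIdeal_le_facePrime hΔ hG.1⟩ hle)⟩
  · rintro ⟨G, hG, rfl⟩
    refine ⟨⟨isPrime_facePrime G, srIdeal_le_facePrime hΔ hG.1⟩, fun q hq hle => ?_⟩
    obtain ⟨H, hH, hHq⟩ := exists_facePrime_le hq.1 hq.2
    rwa [hG.2 H hH.1 (facePrime_le_facePrime_iff.1 (hHq.trans hle))]

lemma map_srIdeal_atPrime {Δ : FaceSet ι} (hΔ : IsSimplicialComplex Δ) {G : Finset ι}
    (hG : G ∈ facets Δ) :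
    (srIdeal K Δ).map (algebraMap _ (Localization.AtPrime (facePrime K G))) =
      (facePrime K G).map (algebraMap _ (Localization.AtPrime (facePrime K G))) := by
  classical
  refine le_antisymm (Ideal.map_mono (srIdeal_le_facePrime hΔ hG.1)) ?_
  rw [Ideal.map_le_iff_le_comap]
  refine Ideal.span_le.2 ?_
  rintro _ ⟨i, hi, rfl⟩
  have hi : i ∉ G := hi
  rw [SetLike.mem_coe, Ideal.mem_comap,
    IsLocalization.algebraMap_mem_map_algebraMap_iff (facePrime K G).primeCompl]
  refine ⟨∏ j ∈ G, X j, fun h => ?_, Ideal.subset_span ⟨insert i G, fun h => ?_, ?_⟩⟩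
  · obtain ⟨j, hj, hjG⟩ := ((isPrime_facePrime G).prod_mem_iff).1 h
    exact X_mem_facePrime_iff.1 hjG hj
  · exact hi (hG.2 _ h (Finset.subset_insert i G) ▸ Finset.mem_insert_self i G)
  · rw [Finset.prod_insert hi, mul_comm]

variable [Fintype ι] [DecidableEq ι]

lemma le_sum_compl_of_mem_facePrime_pow {G : Finset ι} {n : ℕ} {f : MvPolynomial ι K}
    (hf : f ∈ facePrime K G ^ n) : ∀ b ∈ f.support, n ≤ ∑ i ∈ Gᶜ, b i := by
  induction n generalizing f with
  | zero => simp
  | succ n ih =>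
    rw [pow_succ'] at hf
    induction hf using Submodule.mul_induction_on' with
    | mem_mul_mem p hp q hq =>
      intro b hb
      obtain ⟨c, hc, d, hd, rfl⟩ := Finset.mem_add.1 (support_mul p q hb)
      obtain ⟨i, hi, hne⟩ := mem_facePrime_iff.1 hp c hc
      have h₁ := ih hq d hd
      have h₂ : c i ≤ ∑ i ∈ Gᶜ, c i :=
        Finset.single_le_sum (fun _ _ => Nat.zero_le _) (Finset.mem_compl.2 hi)
      simp only [Finsupp.add_apply, Finset.sum_add_distrib]
      omega
    | add p _ q _ hp hq =>
      intro b hb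
      rcases Finset.mem_union.1 (support_add hb) with h | h
      exacts [hp b h, hq b h]

lemma monomial_mem_facePrime_pow {G : Finset ι} {n : ℕ} {a : ι →₀ ℕ}
    (h : n ≤ ∑ i ∈ Gᶜ, a i) : monomial a (1 : K) ∈ facePrime K G ^ n := by
  refine Ideal.pow_le_pow_right h ?_
  rw [monomial_eq, C_1, one_mul, Finsupp.prod_fintype _ _ (by simp),
    ← Finset.prod_compl_mul_prod G, ← Finset.prod_pow_eq_pow_sum]
  exact Ideal.mul_mem_right _ _ (Ideal.prod_mem_prod fun i hi =>
    Ideal.pow_mem_pow (X_mem_facePrime (Finset.mem_compl.1 hi)) _)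

lemma monomial_mem_comap_map_facePrime_pow_iff {G : Finset ι} {n : ℕ} {a : ι →₀ ℕ} :
    algebraMap _ (Localization.AtPrime (facePrime K G)) (monomial a (1 : K)) ∈
      (facePrime K G ^ n).map (algebraMap _ (Localization.AtPrime (facePrime K G))) ↔
      n ≤ ∑ i ∈ Gᶜ, a i := by
  refine ⟨fun h => ?_, fun h => Ideal.mem_map_of_mem _ (monomial_mem_facePrime_pow h)⟩
  rw [IsLocalization.algebraMap_mem_map_algebraMap_iff (facePrime K G).primeCompl] at h
  obtain ⟨s, hs, hmem⟩ := h
  have hs : s ∉ facePrime K G := hs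
  rw [mem_facePrime_iff] at hs
  push Not at hs
  obtain ⟨b, hb, hzero⟩ := hs
  have h := le_sum_compl_of_mem_facePrime_pow hmem (b + a) (by
    rw [mem_support_iff, coeff_mul_monomial, mul_one]
    exact mem_support_iff.1 hb)
  simpa [Finset.sum_add_distrib,
    Finset.sum_eq_zero fun i hi => hzero i (Finset.mem_compl.1 hi)] using h

/-- Monomials in the symbolic powers of a Stanley–Reisner ideal. -/
lemma monomial_mem_symbolicPower_iff {Δ : FaceSet ι} (hΔ : IsSimplicialComplex Δ) {n : ℕ}
    {a : ι →₀ ℕ} :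
    monomial a (1 : K) ∈ symbolicPower (srIdeal K Δ) n ↔
      ∀ G ∈ facets Δ, n ≤ ∑ i ∈ Gᶜ, a i := by
  simp only [symbolicPower, Submodule.mem_iInf, Ideal.mem_comap]
  have key : ∀ G ∈ facets Δ,
      (algebraMap _ (Localization.AtPrime (facePrime K G)) (monomial a (1 : K)) ∈
        (srIdeal K Δ ^ n).map (algebraMap _ (Localization.AtPrime (facePrime K G))) ↔
        n ≤ ∑ i ∈ Gᶜ, a i) := fun G hG => by
    rw [Ideal.map_pow, map_srIdeal_atPrime hΔ hG, ← Ideal.map_pow,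
      monomial_mem_comap_map_facePrime_pow_iff]
  constructor
  · intro h G hG
    exact (key G hG).1 (h _ ((minimalPrimes_srIdeal (K := K) hΔ).symm.subset ⟨G, hG, rfl⟩))
  · intro h p hp
    obtain ⟨G, hG, rfl⟩ := (minimalPrimes_srIdeal hΔ).subset hp
    exact (key G hG).2 (h G hG)

end

lemma negSupport_natCast {ι : Type*} [Fintype ι] (α : ι → ℕ) :
    negSupport (fun j => (α j : ℤ)) = ∅ := by
  simp [negSupport]

/-- The degree complex of a symbolic power at a nonnegative degree `α` is generated by the
facets `G` with `∑_{i ∉ G} α_i < n`. -/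
lemma degreeComplex_symbolicPower {K : Type*} [Field K] {ι : Type*} [Fintype ι] [LinearOrder ι]
    {Δ : FaceSet ι} (hΔ : IsSimplicialComplex Δ) (n : ℕ) (α : ι → ℕ) :
    degreeComplex K (symbolicPower (srIdeal K Δ) n) (fun j => (α j : ℤ)) =
      {τ | ∃ G ∈ facets Δ, ∑ i ∈ Gᶜ, α i < n ∧ τ ⊆ G} := by
  ext τ
  have hmon : ∀ m : ℕ, monomial (Finsupp.equivFunOnFinite.symm fun i => ((α i : ℤ)).toNat) (1 : K) *
      (∏ i ∈ τ ∪ negSupport (fun j => (α j : ℤ)), X i) ^ m =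
      monomial (Finsupp.equivFunOnFinite.symm fun i => α i + if i ∈ τ then m else 0) 1 := by
    intro m
    rw [negSupport_natCast, Finset.union_empty, ← Finset.prod_pow, monomial_eq, monomial_eq,
      Finsupp.prod_fintype _ _ (by simp), Finsupp.prod_fintype _ _ (by simp)]
    simp only [C_1, one_mul, Finsupp.equivFunOnFinite_symm_apply_apply, Int.toNat_natCast, pow_add,
      Finset.prod_mul_distrib, pow_ite, pow_zero, Finset.prod_ite_mem, Finset.univ_inter]
  simp only [degreeComplex, Set.mem_ofPred_eq, hmon, monomial_mem_symbolicPower_iff hΔ]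
  simp only [Int.natCast_nonneg, implies_true, true_and, Finsupp.equivFunOnFinite_symm_apply_apply,
    Finset.sum_add_distrib]
  push Not
  constructor
  · intro h
    obtain ⟨G, hG, hlt⟩ := h n
    refine ⟨G, hG, by omega, fun i hi => ?_⟩
    by_contra hiG
    have h₁ := Finset.single_le_sum (f := fun i => if i ∈ τ then n else 0)
      (fun _ _ => Nat.zero_le _) (Finset.mem_compl.2 hiG)
    simp only [hi, if_true] at h₁
    omega
  · rintro ⟨G, hG, hlt, hτ⟩ m
    refine ⟨G, hG, ?_⟩
    rwa [Finset.sum_eq_zero (f := fun i => if i ∈ τ then m else 0) fun i hi =>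
      if_neg fun h => Finset.mem_compl.1 hi (hτ h), add_zero]

/-- In the situation where `Δ` has facets `F_1, …, F_t`, with
`H_𝔪^i(R/I_Δ^{(n)})_α ≠ 0` for some `n ≥ 1`, `i ≥ 0`, `α ∈ ℕ^r`, and
`F(Δ_α(I_Δ^{(n)})) = {F_1, …, F_s}`: for every `m ≥ 1` and every
`β ∈ P_m ∩ ℕ^r` one has `Δ_β(I_Δ^{(m)}) = ⟨F_1, …, F_s⟩ = Δ_α(I_Δ^{(n)})` and
`H_𝔪^i(R/I_Δ^{(m)})_β ≠ 0`. -/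
theorem statement9 {K : Type*} [Field K] {r t s : ℕ}
    (Δ : FaceSet (Fin r)) (hΔ : IsSimplicialComplex Δ)
    (F : Fin t → Finset (Fin r)) (hFinj : Function.Injective F)
    (hF : facets Δ = Set.range F)
    (n : ℕ) (hn : 1 ≤ n) (i : ℕ) (α : Fin r → ℕ)
    (hlc : lcNonzero K (symbolicPower (srIdeal K Δ) n) i (fun j => (α j : ℤ)))
    (hs : 1 ≤ s) (hst : s ≤ t)
    (hfac : facets (degreeComplex K (symbolicPower (srIdeal K Δ) n) (fun j => (α j : ℤ)))
      = F '' {j : Fin t | (j : ℕ) < s}) :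
    ∀ m : ℕ, 1 ≤ m → ∀ β : Fin r → ℕ, (fun j => (β j : ℝ)) ∈ polyP F s m →
      degreeComplex K (symbolicPower (srIdeal K Δ) m) (fun j => (β j : ℤ))
          = {τ : Finset (Fin r) | ∃ j : Fin t, (j : ℕ) < s ∧ τ ⊆ F j} ∧
      degreeComplex K (symbolicPower (srIdeal K Δ) n) (fun j => (α j : ℤ))
          = {τ : Finset (Fin r) | ∃ j : Fin t, (j : ℕ) < s ∧ τ ⊆ F j} ∧
      lcNonzero K (symbolicPower (srIdeal K Δ) m) i (fun j => (β j : ℤ)) := by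
  intro m _ β hβ
  have hα : degreeComplex K (symbolicPower (srIdeal K Δ) n) (fun j => (α j : ℤ))
      = {τ : Finset (Fin r) | ∃ j : Fin t, (j : ℕ) < s ∧ τ ⊆ F j} := by
    ext τ
    constructor
    · intro hτ
      obtain ⟨G, hG, hτG⟩ := exists_mem_facets_of_mem hτ
      rw [hfac] at hG
      obtain ⟨j, hj, rfl⟩ := hG
      exact ⟨j, hj, hτG⟩
    · rintro ⟨j, hj, hτ⟩
      have hFj : F j ∈ facets (degreeComplex K (symbolicPower (srIdeal K Δ) n)
          (fun j => (α j : ℤ))) := hfac ▸ ⟨j, hj, rfl⟩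
      have hmem := hFj.1
      rw [degreeComplex_symbolicPower hΔ] at hmem ⊢
      obtain ⟨G, hG, hlt, hsub⟩ := hmem
      exact ⟨G, hG, hlt, hτ.trans hsub⟩
  have hlt : ∀ j : Fin t, ∑ i ∈ (F j)ᶜ, β i < m ↔ (j : ℕ) < s := by
    intro j
    constructor
    · intro h
      by_contra hj
      have h' : (m : ℝ) ≤ ∑ i ∈ (F j)ᶜ, (β i : ℝ) := (hβ.2 j).2 (not_lt.1 hj)
      exact (not_le.2 h) (by exact_mod_cast h')
    · intro hj
      have h' : (∑ i ∈ (F j)ᶜ, (β i : ℝ)) + 1 ≤ m := by linarith [(hβ.2 j).1 hj]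
      exact_mod_cast h'
  have hβ' : degreeComplex K (symbolicPower (srIdeal K Δ) m) (fun j => (β j : ℤ))
      = {τ : Finset (Fin r) | ∃ j : Fin t, (j : ℕ) < s ∧ τ ⊆ F j} := by
    rw [degreeComplex_symbolicPower hΔ, hF]
    simp only [Set.exists_range_iff, hlt]
  refine ⟨hβ', hα, ?_⟩
  rw [lcNonzero, negSupport_natCast, hα] at hlc
  rwa [lcNonzero, negSupport_natCast, hβ']
end

section
/- Let Δ be a simplicial complex on {1,…,r} and let simp(Δ) = {lk_Δ(σ) : σ ∈ Δ}. Let f : simp(Δ) → ℕ be a function such that (1) f(Λ) = 0 whenever Λ ∈ simp(Δ) is a simplex, and (2) for every Λ ∈ simp(Δ) and every vertex v of Λ such that Λ is not a cone over v, f(lk_Λ(v)) + 1 ≤ f(Λ). Then for every subcomplex Γ of Δ with F(Γ) ⊆ F(Δ), one has reg(I_Γ) ≤ f(Δ) + 1. -/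
open MvPolynomial Finset Filter

/-- The link `lk_Δ(F) = {H ∈ Δ : H ∪ F ∈ Δ, H ∩ F = ∅}`. -/
def linkOf {ι : Type*} [DecidableEq ι] (Δ : FaceSet ι) (F : Finset ι) : FaceSet ι :=
  {H | H ∈ Δ ∧ H ∪ F ∈ Δ ∧ Disjoint H F}

/-- The vertices of a face set: elements appearing in some face. -/
def verticesOf {ι : Type*} (Δ : FaceSet ι) : Set ι := {v | ∃ F ∈ Δ, v ∈ F}

/-- `Δ` is a cone over the vertex `v`: `{v} ∪ F ∈ Δ` for every `F ∈ Δ`. -/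
def IsConeOver {ι : Type*} [DecidableEq ι] (Δ : FaceSet ι) (v : ι) : Prop :=
  ∀ F ∈ Δ, insert v F ∈ Δ

/-- A face set is a simplex if it contains all subsets of its vertex set. -/
def IsSimplexFaceSet {ι : Type*} (Δ : FaceSet ι) : Prop :=
  ∀ τ : Finset ι, (∀ v ∈ τ, v ∈ verticesOf Δ) → τ ∈ Δ
section Deletion

variable {ι : Type*}

/-- The deletion of the vertex `v`: the faces not containing `v`. -/
def deletionOf (Δ : FaceSet ι) (v : ι) : FaceSet ι := {σ | σ ∈ Δ ∧ v ∉ σ}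

lemma deletionOf_subset (Δ : FaceSet ι) (v : ι) : deletionOf Δ v ⊆ Δ := fun _ hσ => hσ.1

lemma IsSimplicialComplex.deletionOf {Δ : FaceSet ι} (hΔ : IsSimplicialComplex Δ) (v : ι) :
    IsSimplicialComplex (deletionOf Δ v) := fun σ hσ τ hτ =>
  ⟨hΔ σ hσ.1 τ hτ, fun hv => hσ.2 (hτ hv)⟩

end Deletion

section CardFaces

variable {K : Type*} [Field K] {ι : Type*}

lemma single_mem_cardFaces {Δ : FaceSet ι} {σ : Finset ι} {d : ℕ} (hσ : σ ∈ Δ)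
    (hd : σ.card = d) : Finsupp.single σ (1 : K) ∈ cardFaces K Δ d :=
  Submodule.subset_span ⟨σ, hσ, hd, rfl⟩

lemma map_mem_cardFaces {Δ Δ' : FaceSet ι} {d d' : ℕ}
    (T : (Finset ι →₀ K) →ₗ[K] (Finset ι →₀ K))
    (hT : ∀ σ ∈ Δ, σ.card = d → T (Finsupp.single σ 1) ∈ cardFaces K Δ' d')
    {z : Finset ι →₀ K} (hz : z ∈ cardFaces K Δ d) : T z ∈ cardFaces K Δ' d' := by
  have : cardFaces K Δ d ≤ (cardFaces K Δ' d').comap T := by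
    rw [cardFaces, Submodule.span_le]
    rintro _ ⟨σ, hσ, hd, rfl⟩
    exact hT σ hσ hd
  exact this hz

lemma cardFaces_mono {Δ Δ' : FaceSet ι} (h : Δ ⊆ Δ') (d : ℕ) :
    cardFaces K Δ d ≤ cardFaces K Δ' d :=
  fun _ hz => map_mem_cardFaces LinearMap.id (fun _ hσ hd => single_mem_cardFaces (h hσ) hd) hz

end CardFaces

section ChainOperators

variable (K : Type*) [Field K] {ι : Type*} [LinearOrder ι]

/-- The incidence sign of `v` relative to `σ`. -/
def incidenceSign (v : ι) (σ : Finset ι) : K := (-1) ^ (σ.filter fun w => w < v).card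

/-- The operator `σ ↦ ± (σ ∪ {v})`, vanishing on the sets containing `v`. -/
noncomputable def coneMap (v : ι) : (Finset ι →₀ K) →ₗ[K] (Finset ι →₀ K) :=
  Finsupp.lsum K fun σ => LinearMap.toSpanSingleton K _
    (if v ∈ σ then 0 else incidenceSign K v σ • Finsupp.single (insert v σ) (1 : K))

/-- The operator `σ ↦ ± (σ \ {v})`, vanishing on the sets not containing `v`. -/
noncomputable def contraction (v : ι) : (Finset ι →₀ K) →ₗ[K] (Finset ι →₀ K) :=
  Finsupp.lsum K fun σ => LinearMap.toSpanSingleton K _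
    (if v ∈ σ then incidenceSign K v σ • Finsupp.single (σ.erase v) (1 : K) else 0)

variable {K}

lemma incidenceSign_mul_self (v : ι) (σ : Finset ι) :
    incidenceSign K v σ * incidenceSign K v σ = 1 := by
  rw [incidenceSign, ← mul_pow]
  simp

lemma incidenceSign_insert {u : ι} (v : ι) {σ : Finset ι} (hu : u ∉ σ) :
    incidenceSign K v (insert u σ) = (if u < v then -1 else 1) * incidenceSign K v σ := by
  unfold incidenceSign
  rw [Finset.filter_insert]
  split_ifs
  · rw [Finset.card_insert_of_notMem (by simp [hu]), pow_succ']
  · simp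

lemma incidenceSign_erase {u : ι} (v : ι) {σ : Finset ι} (hu : u ∈ σ) :
    incidenceSign K v σ = (if u < v then -1 else 1) * incidenceSign K v (σ.erase u) := by
  rw [← incidenceSign_insert v (Finset.notMem_erase u σ), Finset.insert_erase hu]

lemma bdry_single (σ : Finset ι) :
    bdry K (Finsupp.single σ 1) =
      ∑ v ∈ σ, incidenceSign K v σ • Finsupp.single (σ.erase v) (1 : K) := by
  simp [bdry, incidenceSign]

lemma coneMap_single (v : ι) (σ : Finset ι) :
    coneMap K v (Finsupp.single σ 1) =
      if v ∈ σ then 0 else incidenceSign K v σ • Finsupp.single (insert v σ) (1 : K) := by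
  simp [coneMap]

lemma contraction_single (v : ι) (σ : Finset ι) :
    contraction K v (Finsupp.single σ 1) =
      if v ∈ σ then incidenceSign K v σ • Finsupp.single (σ.erase v) (1 : K) else 0 := by
  simp [contraction]

lemma bdry_coneMap_single (v : ι) (σ : Finset ι) :
    bdry K (coneMap K v (Finsupp.single σ 1)) + coneMap K v (bdry K (Finsupp.single σ 1)) =
      Finsupp.single σ 1 := by
  rw [coneMap_single, bdry_single, map_sum]
  simp only [map_smul, coneMap_single]
  by_cases hv : v ∈ σ
  · rw [if_pos hv, map_zero, zero_add, Finset.sum_eq_single_of_mem v hv]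
    · rw [if_neg (Finset.notMem_erase v σ), Finset.insert_erase hv, smul_smul,
        incidenceSign_erase v hv, if_neg (lt_irrefl v), one_mul, incidenceSign_mul_self, one_smul]
    · intro w _ hwv
      rw [if_pos (Finset.mem_erase.2 ⟨hwv.symm, hv⟩), smul_zero]
  · rw [if_neg hv, map_smul, bdry_single, Finset.sum_insert hv, smul_add, Finset.erase_insert hv,
      smul_smul, incidenceSign_insert v hv, if_neg (lt_irrefl v), one_mul, incidenceSign_mul_self,
      one_smul, add_assoc, add_eq_left, Finset.smul_sum, ← Finset.sum_add_distrib]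
    refine Finset.sum_eq_zero fun w hw => ?_
    have hwv : w ≠ v := fun h => hv (h ▸ hw)
    rw [if_neg fun h => hv (Finset.mem_of_mem_erase h), Finset.erase_insert_of_ne hwv.symm,
      smul_smul, smul_smul, ← add_smul, incidenceSign_insert w hv, incidenceSign_erase v hw]
    rcases lt_or_gt_of_ne hwv with h | h
    · rw [if_pos h, if_neg h.asymm]
      convert zero_smul K _ using 2
      ring
    · rw [if_pos h, if_neg h.asymm]
      convert zero_smul K _ using 2
      ring

lemma bdry_contraction_single (v : ι) (σ : Finset ι) :
    bdry K (contraction K v (Finsupp.single σ 1)) +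
      contraction K v (bdry K (Finsupp.single σ 1)) = 0 := by
  rw [contraction_single, bdry_single, map_sum]
  simp only [map_smul, contraction_single]
  by_cases hv : v ∈ σ
  · rw [if_pos hv, map_smul, bdry_single, ← Finset.add_sum_erase σ _ hv,
      if_neg (Finset.notMem_erase v σ), smul_zero, zero_add, Finset.smul_sum,
      ← Finset.sum_add_distrib]
    refine Finset.sum_eq_zero fun w hw => ?_
    obtain ⟨hwv, hw⟩ := Finset.mem_erase.1 hw
    rw [if_pos (Finset.mem_erase.2 ⟨hwv.symm, hv⟩), smul_smul, smul_smul,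
      Finset.erase_right_comm, ← add_smul, incidenceSign_erase v hw, incidenceSign_erase w hv]
    rcases lt_or_gt_of_ne hwv with h | h
    · rw [if_pos h, if_neg h.asymm]
      convert zero_smul K _ using 2
      ring
    · rw [if_pos h, if_neg h.asymm]
      convert zero_smul K _ using 2
      ring
  · rw [if_neg hv, map_zero, zero_add]
    refine Finset.sum_eq_zero fun w _ => ?_
    rw [if_neg fun h => hv (Finset.mem_of_mem_erase h), smul_zero]

/-- `coneMap` is a contracting homotopy for the boundary operator. -/
lemma bdry_coneMap (v : ι) (z : Finset ι →₀ K) :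
    bdry K (coneMap K v z) + coneMap K v (bdry K z) = z := by
  have h : bdry K ∘ₗ coneMap K v + coneMap K v ∘ₗ bdry K = LinearMap.id := by
    ext1 σ
    ext1
    exact bdry_coneMap_single v σ
  exact LinearMap.congr_fun h z

lemma bdry_contraction (v : ι) (z : Finset ι →₀ K) :
    bdry K (contraction K v z) + contraction K v (bdry K z) = 0 := by
  have h : bdry K ∘ₗ contraction K v + contraction K v ∘ₗ bdry K = 0 := by
    ext1 σ
    ext1
    exact bdry_contraction_single v σ
  exact LinearMap.congr_fun h z

lemma coneMap_mem_cardFaces {Δ Δ' : FaceSet ι} {v : ι}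
    (h : ∀ σ ∈ Δ, v ∉ σ → insert v σ ∈ Δ') {d : ℕ} {z : Finset ι →₀ K}
    (hz : z ∈ cardFaces K Δ d) : coneMap K v z ∈ cardFaces K Δ' (d + 1) := by
  refine map_mem_cardFaces _ (fun σ hσ hd => ?_) hz
  rw [coneMap_single]
  split_ifs with hv
  · exact zero_mem _
  · exact Submodule.smul_mem _ _
      (single_mem_cardFaces (h σ hσ hv) (by rw [Finset.card_insert_of_notMem hv, hd]))

/-- A complex with nontrivial reduced homology is not a cone. -/
lemma HasNontrivialReducedHomology.not_isConeOver {Δ : FaceSet ι} {j : ℤ}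
    (h : HasNontrivialReducedHomology K Δ j) (v : ι) : ¬IsConeOver Δ v := by
  intro hv
  obtain ⟨d, -, z, hz, hbz, hz'⟩ := h
  refine hz' ⟨coneMap K v z, coneMap_mem_cardFaces (fun σ hσ _ => hv σ hσ) hz, ?_⟩
  simpa [hbz] using bdry_coneMap v z

/-- A face set with nontrivial reduced homology in degree `j` has a `j`-dimensional face. -/
lemma HasNontrivialReducedHomology.exists_face {Δ : FaceSet ι} {j : ℤ}
    (h : HasNontrivialReducedHomology K Δ j) : ∃ σ ∈ Δ, (σ.card : ℤ) = j + 1 := by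
  obtain ⟨d, hd, z, hz, -, hz'⟩ := h
  by_contra! hΔ
  have hbot : cardFaces K Δ d = ⊥ := by
    rw [cardFaces, Submodule.span_eq_bot]
    rintro _ ⟨σ, hσ, hσd, -⟩
    exact absurd (by omega) (hΔ σ hσ)
  rw [hbot, Submodule.mem_bot] at hz
  exact hz' ⟨0, zero_mem _, by rw [map_zero, hz]⟩

/-- Nontrivial reduced homology of a complex is inherited by the deletion of a vertex in the same
degree or by its link one degree lower. -/
lemma HasNontrivialReducedHomology.deletion_or_link {Δ : FaceSet ι} (hΔ : IsSimplicialComplex Δ)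
    {d : ℕ} (h : HasNontrivialReducedHomology K Δ d) (v : ι) :
    HasNontrivialReducedHomology K (deletionOf Δ v) d ∨
      HasNontrivialReducedHomology K (linkOf Δ {v}) (d - 1) := by
  obtain ⟨e, he, z, hz, hbz, hz'⟩ := h
  obtain rfl : e = d + 1 := by omega
  by_contra! hcon
  obtain ⟨hdel, hlk⟩ := hcon
  set b := contraction K v z with hb
  have hbb : bdry K b = 0 := by simpa [hbz] using bdry_contraction v z
  have hblk : b ∈ cardFaces K (linkOf Δ {v}) d := by
    refine map_mem_cardFaces _ (fun σ hσ hd => ?_) hz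
    rw [contraction_single]
    split_ifs with hv
    · refine Submodule.smul_mem _ _ (single_mem_cardFaces ⟨?_, ?_, ?_⟩ ?_)
      · exact hΔ σ hσ _ (Finset.erase_subset _ _)
      · rwa [Finset.union_comm, ← Finset.insert_eq, Finset.insert_erase hv]
      · simp
      · rw [Finset.card_erase_of_mem hv, hd, Nat.add_sub_cancel]
    · exact zero_mem _
  have ha : z - coneMap K v b ∈ cardFaces K (deletionOf Δ v) (d + 1) := by
    refine map_mem_cardFaces (LinearMap.id - coneMap K v ∘ₗ contraction K v)
      (fun σ hσ hd => ?_) hz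
    rw [LinearMap.sub_apply, LinearMap.comp_apply, contraction_single, LinearMap.id_apply]
    split_ifs with hv
    · rw [map_smul, coneMap_single, if_neg (Finset.notMem_erase v σ), Finset.insert_erase hv,
        smul_smul, incidenceSign_erase v hv, if_neg (lt_irrefl v), one_mul,
        incidenceSign_mul_self, one_smul, sub_self]
      exact zero_mem _
    · rw [map_zero, sub_zero]
      exact single_mem_cardFaces ⟨hσ, hv⟩ hd
  obtain ⟨c, hc, hcb⟩ : b ∈ ⇑(bdry K) '' ↑(cardFaces K (linkOf Δ {v}) (d + 1)) := by
    by_contra hb'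
    exact hlk ⟨d, by omega, b, hblk, hbb, hb'⟩
  have hbcone : bdry K (coneMap K v b) = b := by simpa [hbb] using bdry_coneMap v b
  have hccone : bdry K (coneMap K v c) = c - coneMap K v b := by
    rw [eq_sub_iff_add_eq, ← hcb]
    exact bdry_coneMap v c
  have hsub : linkOf Δ {v} ⊆ deletionOf Δ v := fun σ hσ =>
    ⟨hσ.1, Finset.disjoint_singleton_right.1 hσ.2.2⟩
  have hac : z - coneMap K v b + c ∈ cardFaces K (deletionOf Δ v) (d + 1) :=
    add_mem ha (cardFaces_mono hsub _ hc)
  obtain ⟨y, hy, hyac⟩ : z - coneMap K v b + c ∈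
      ⇑(bdry K) '' ↑(cardFaces K (deletionOf Δ v) (d + 1 + 1)) := by
    by_contra hac'
    refine hdel ⟨d + 1, by omega, _, hac, ?_, hac'⟩
    rw [map_add, map_sub, hbz, hbcone, hcb, zero_sub, neg_add_cancel]
  refine hz' ⟨y - coneMap K v c, sub_mem (cardFaces_mono (deletionOf_subset Δ v) _ hy)
    (coneMap_mem_cardFaces (fun σ hσ _ => ?_) hc), ?_⟩
  · rw [Finset.insert_eq, Finset.union_comm]
    exact hσ.2.1
  · rw [map_sub, hyac, hccone]
    abel

end ChainOperators

section Links

variable {ι : Type*}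

lemma exists_facet_superset [Finite ι] {Δ : FaceSet ι} {σ : Finset ι} (hσ : σ ∈ Δ) :
    ∃ τ ∈ facets Δ, σ ⊆ τ := by
  obtain ⟨τ, hστ, hτ⟩ := (Set.toFinite Δ).exists_le_maximal hσ
  exact ⟨τ, ⟨hτ.prop, fun ρ hρ h => hτ.eq_of_le hρ h⟩, hστ⟩

variable [DecidableEq ι]

lemma IsSimplicialComplex.linkOf {Δ : FaceSet ι} (hΔ : IsSimplicialComplex Δ) (F : Finset ι) :
    IsSimplicialComplex (linkOf Δ F) := fun _ hσ _ hτ =>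
  ⟨hΔ _ hσ.1 _ hτ, hΔ _ hσ.2.1 _ (Finset.union_subset_union_left hτ),
    Finset.disjoint_of_subset_left hτ hσ.2.2⟩

lemma linkOf_empty (Δ : FaceSet ι) : linkOf Δ ∅ = Δ := by
  ext σ
  simp [linkOf]

lemma mem_linkOf_singleton {Δ : FaceSet ι} (hΔ : IsSimplicialComplex Δ) {v : ι} {σ : Finset ι} :
    σ ∈ linkOf Δ {v} ↔ insert v σ ∈ Δ ∧ v ∉ σ := by
  rw [linkOf, Set.mem_ofPred_eq, Finset.union_comm, ← Finset.insert_eq,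
    Finset.disjoint_singleton_right]
  exact ⟨fun h => h.2, fun h => ⟨hΔ _ h.1 _ (Finset.subset_insert _ _), h⟩⟩

lemma linkOf_linkOf_singleton {Δ : FaceSet ι} (hΔ : IsSimplicialComplex Δ) {σ : Finset ι} {v : ι}
    (hv : v ∉ σ) : linkOf (linkOf Δ σ) {v} = linkOf Δ (insert v σ) := by
  ext H
  rw [mem_linkOf_singleton (hΔ.linkOf σ)]
  simp only [linkOf, Set.mem_ofPred_eq, Finset.disjoint_insert_left, Finset.disjoint_insert_right,
    Finset.insert_union, Finset.union_insert]
  constructor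
  · rintro ⟨⟨h1, h2, -, h3⟩, h4⟩
    exact ⟨hΔ _ h1 _ (Finset.subset_insert _ _), h2, h4, h3⟩
  · rintro ⟨-, h2, h4, h3⟩
    exact ⟨⟨hΔ _ h2 _ (Finset.insert_subset_insert _ Finset.subset_union_left), h2, hv, h3⟩, h4⟩

/-- `Δ` is a sub-face-set of `Λ` in which every failure of a vertex of `Δ` to extend a face of `Δ`
is witnessed in `Λ` on a larger face. -/
structure IsObstructionPreserving (Δ Λ : FaceSet ι) : Prop where
  subset : Δ ⊆ Λ
  exists_superset : ∀ F ∈ Δ, ∀ v ∈ verticesOf Δ, insert v F ∉ Δ →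
    ∃ F' ∈ Λ, F ⊆ F' ∧ insert v F' ∉ Λ

lemma IsObstructionPreserving.deletionOf {Δ Λ : FaceSet ι} (h : IsObstructionPreserving Δ Λ)
    (v : ι) : IsObstructionPreserving (deletionOf Δ v) Λ where
  subset _ hσ := h.subset hσ.1
  exists_superset F hF w hw hwF := by
    obtain ⟨H, hH, hwH⟩ := hw
    refine h.exists_superset F hF.1 w ⟨H, hH.1, hwH⟩ fun hins => hwF ⟨hins, ?_⟩
    rw [Finset.mem_insert, not_or]
    exact ⟨fun hvw => hH.2 (hvw ▸ hwH), hF.2⟩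

lemma IsObstructionPreserving.linkOf_singleton {Δ Λ : FaceSet ι} (h : IsObstructionPreserving Δ Λ)
    (hΔ : IsSimplicialComplex Δ) (hΛ : IsSimplicialComplex Λ) (v : ι) :
    IsObstructionPreserving (linkOf Δ {v}) (linkOf Λ {v}) where
  subset _ hσ := ⟨h.subset hσ.1, h.subset hσ.2.1, hσ.2.2⟩
  exists_superset F hF w hw hwF := by
    rw [mem_linkOf_singleton hΔ] at hF hwF
    obtain ⟨H, hH, hwH⟩ := hw
    rw [mem_linkOf_singleton hΔ] at hH
    have hvw : v ≠ w := fun hvw => hH.2 (hvw ▸ hwH)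
    obtain ⟨F', hF', hFF', hwF'⟩ := h.exists_superset (insert v F) hF.1 w
      ⟨_, hH.1, Finset.mem_insert_of_mem hwH⟩ fun hins => hwF
        ⟨by rwa [Finset.insert_comm], by simp [hvw, hF.2]⟩
    have hvF' : v ∈ F' := hFF' (Finset.mem_insert_self v F)
    refine ⟨F'.erase v, ?_, ?_, ?_⟩
    · rw [mem_linkOf_singleton hΛ, Finset.insert_erase hvF']
      exact ⟨hF', Finset.notMem_erase v F'⟩
    · exact Finset.subset_erase.2 ⟨(Finset.subset_insert _ _).trans hFF', hF.2⟩
    · rw [mem_linkOf_singleton hΛ, Finset.insert_comm, Finset.insert_erase hvF']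
      exact fun hins => hwF' hins.1

/-- Links of a complex generated by facets of `Δ` preserve the obstructions of `Δ`. -/
lemma isObstructionPreserving_linkOf [Finite ι] {Γ Δ : FaceSet ι} (hΓ : IsSimplicialComplex Γ)
    (hΓΔ : Γ ⊆ Δ) (hfac : facets Γ ⊆ facets Δ) (G : Finset ι) :
    IsObstructionPreserving (linkOf Γ G) Δ where
  subset _ hσ := hΓΔ hσ.1
  exists_superset F hF w hw hwF := by
    obtain ⟨H, hH, hwH⟩ := hw
    obtain ⟨F', hF', hFF'⟩ := exists_facet_superset hF.2.1
    refine ⟨F', (hfac hF').1, Finset.union_subset_left hFF', fun hins => hwF ?_⟩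
    have hwF' : w ∈ F' := by
      rw [(hfac hF').2 _ hins (Finset.subset_insert _ _)]
      exact Finset.mem_insert_self w F'
    have hunion : insert w F ∪ G ∈ Γ := by
      rw [Finset.insert_union]
      exact hΓ _ hF'.1 _ (Finset.insert_subset hwF' hFF')
    refine ⟨hΓ _ hunion _ Finset.subset_union_left, hunion, ?_⟩
    rw [Finset.disjoint_insert_left]
    exact ⟨Finset.disjoint_left.1 hH.2.2 hwH, hF.2.2⟩

end Links

section HomologyBound

variable {K : Type*} [Field K] {ι : Type*} [LinearOrder ι] [Finite ι]

/-- Nontrivial reduced homology of a complex preserving the obstructions of a link of `Δ` is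
bounded by any function dropping along links at vertices that are not cone points. -/
lemma HasNontrivialReducedHomology.le_of_isObstructionPreserving
    {Δ : FaceSet ι} (hΔ : IsSimplicialComplex Δ) (f : FaceSet ι → ℕ)
    (hf : ∀ σ ∈ Δ, ∀ v ∈ verticesOf (linkOf Δ σ), ¬IsConeOver (linkOf Δ σ) v →
      f (linkOf (linkOf Δ σ) {v}) + 1 ≤ f (linkOf Δ σ))
    {Γ : FaceSet ι} (hΓ : IsSimplicialComplex Γ) {σ : Finset ι} (hσ : σ ∈ Δ)
    (hΓσ : IsObstructionPreserving Γ (linkOf Δ σ)) {d : ℕ}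
    (hd : HasNontrivialReducedHomology K Γ ((d : ℤ) - 1)) : d ≤ f (linkOf Δ σ) := by
  induction hn : Γ.ncard using Nat.strong_induction_on generalizing Γ σ d with
  | _ n ih =>
    subst hn
    rcases d with _ | d
    · exact Nat.zero_le _
    obtain ⟨τ, hτ, hτd⟩ := hd.exists_face
    obtain ⟨v, hv⟩ : τ.Nonempty := Finset.card_pos.1 (by omega)
    have hncone := hd.not_isConeOver v
    rw [Nat.cast_add_one, add_sub_cancel_right] at hd
    rcases hd.deletion_or_link hΓ v with h | h
    · refine ih _ (Set.ncard_lt_ncard ?_ (Set.toFinite _)) (hΓ.deletionOf v) hσ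
        (hΓσ.deletionOf v) (by simpa using h) rfl
      exact ⟨deletionOf_subset Γ v, fun hle => (hle hτ).2 hv⟩
    · have hvσ : v ∉ σ := Finset.disjoint_left.1 (hΓσ.subset hτ).2.2 hv
      have hlink := linkOf_linkOf_singleton hΔ hvσ
      have hins : insert v σ ∈ Δ := hΔ _ (hΓσ.subset hτ).2.1 _
        (Finset.insert_subset (Finset.mem_union_left _ hv) Finset.subset_union_right)
      have hle : d ≤ f (linkOf Δ (insert v σ)) := by
        refine ih _ (Set.ncard_lt_ncard ?_ (Set.toFinite _)) (hΓ.linkOf {v}) hins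
          (hlink ▸ hΓσ.linkOf_singleton hΓ (hΔ.linkOf σ) v) h rfl
        exact ⟨fun ρ hρ => hρ.1, fun hle => by simpa [hv] using (hle hτ).2.2⟩
      have hlt := hf σ hσ v ⟨τ, hΓσ.subset hτ, hv⟩ fun hcone => by
        simp only [IsConeOver, not_forall] at hncone
        obtain ⟨F, hF, hvF⟩ := hncone
        obtain ⟨F', hF', -, hvF'⟩ := hΓσ.exists_superset F hF v ⟨τ, hτ, hv⟩ hvF
        exact hvF' (hcone F' hF')
      rw [hlink] at hlt
      omega

end HomologyBound

section StanleyReisner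

variable {K : Type*} [Field K] {ι : Type*}

lemma monomial_mem_srIdeal {Γ : FaceSet ι} (hΓ : IsSimplicialComplex Γ) (u : ι →₀ ℕ) :
    monomial u (1 : K) ∈ srIdeal K Γ ↔ u.support ∉ Γ := by
  classical
  have hgen : {p : MvPolynomial ι K | ∃ τ : Finset ι, τ ∉ Γ ∧ p = ∏ i ∈ τ, X i} =
      (fun s => monomial s (1 : K)) '' {s | ∃ τ : Finset ι, τ ∉ Γ ∧
        s = ∑ i ∈ τ, Finsupp.single i 1} := by
    ext p
    constructor
    · rintro ⟨τ, hτ, rfl⟩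
      exact ⟨_, ⟨τ, hτ, rfl⟩, monomial_sum_one _ _⟩
    · rintro ⟨_, ⟨τ, hτ, rfl⟩, rfl⟩
      exact ⟨τ, hτ, monomial_sum_one _ _⟩
  have hle (τ : Finset ι) : ∑ i ∈ τ, Finsupp.single i 1 ≤ u ↔ τ ⊆ u.support := by
    simp only [Finsupp.le_def, Finsupp.finsetSum_apply, Finsupp.single_apply,
      Finset.sum_ite_eq', Finset.subset_iff, Finsupp.mem_support_iff]
    refine forall_congr' fun i => ?_
    split_ifs with hi <;> simp [hi, Nat.one_le_iff_ne_zero]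
  rw [srIdeal, hgen, mem_ideal_span_monomial_image]
  simp only [support_monomial, one_ne_zero, if_false, Finset.mem_singleton, forall_eq,
    Set.mem_ofPred_eq]
  constructor
  · rintro ⟨_, ⟨τ, hτ, rfl⟩, hτu⟩ hu
    exact hτ (hΓ _ hu _ ((hle τ).1 hτu))
  · exact fun hu => ⟨_, ⟨_, hu, rfl⟩, (hle _).2 subset_rfl⟩

variable [Fintype ι]

lemma sum_le_neg_card_negSupport {α : ι → ℤ} (hα : ∀ i, α i ≤ 0) :
    ∑ i, α i ≤ -((negSupport α).card : ℤ) := by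
  rw [negSupport, Finset.card_filter, Nat.cast_sum, ← Finset.sum_neg_distrib]
  refine Finset.sum_le_sum fun i _ => ?_
  have := hα i
  split_ifs <;> push_cast <;> omega

variable [LinearOrder ι]

lemma mem_degreeComplex_srIdeal {Γ : FaceSet ι} (hΓ : IsSimplicialComplex Γ) (α : ι → ℤ)
    (F : Finset ι) :
    F ∈ degreeComplex K (srIdeal K Γ) α ↔
      (∀ i ∈ F, 0 ≤ α i) ∧ (Finset.univ.filter fun i => 0 < α i) ∪ (F ∪ negSupport α) ∈ Γ := by
  rw [degreeComplex, Set.mem_ofPred_eq]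
  refine and_congr_right fun _ => ?_
  have hmon (m : ℕ) :
      monomial (Finsupp.equivFunOnFinite.symm fun i => (α i).toNat) (1 : K) *
        (∏ i ∈ F ∪ negSupport α, X i) ^ m = monomial
          (Finsupp.equivFunOnFinite.symm (fun i => (α i).toNat) +
            m • ∑ i ∈ F ∪ negSupport α, Finsupp.single i 1) (1 : K) := by
    rw [show (∏ i ∈ F ∪ negSupport α, X i : MvPolynomial ι K) =
      monomial (∑ i ∈ F ∪ negSupport α, Finsupp.single i 1) 1 from (monomial_sum_one _ _).symm,
      monomial_pow, one_pow, monomial_mul, one_mul]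
  have hsupp (m : ℕ) :
      (Finsupp.equivFunOnFinite.symm (fun i => (α i).toNat) +
        m • ∑ i ∈ F ∪ negSupport α, Finsupp.single i 1).support ⊆
          (Finset.univ.filter fun i => 0 < α i) ∪ (F ∪ negSupport α) := by
    intro i hi
    by_contra hcon
    rw [Finset.mem_union, not_or] at hcon
    obtain ⟨hpos, hmem⟩ := hcon
    have : (α i).toNat = 0 := by simpa using hpos
    simp [Finsupp.single_apply, this, hmem] at hi
  have hsupp_one :
      (Finset.univ.filter fun i => 0 < α i) ∪ (F ∪ negSupport α) ⊆
        (Finsupp.equivFunOnFinite.symm (fun i => (α i).toNat) +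
          1 • ∑ i ∈ F ∪ negSupport α, Finsupp.single i 1).support := by
    intro i hi
    rw [Finset.mem_union] at hi
    rw [Finsupp.mem_support_iff, one_smul, Finsupp.add_apply, Finsupp.finsetSum_apply]
    simp only [Finsupp.single_apply, Finset.sum_ite_eq', Finsupp.equivFunOnFinite_symm_apply_apply]
    rcases hi with hi | hi
    · have : 0 < α i := by simpa using hi
      omega
    · rw [if_pos hi]
      omega
  simp only [hmon, monomial_mem_srIdeal hΓ, not_exists, not_not]
  exact ⟨fun h => hΓ _ (h 1) _ hsupp_one, fun h m => hΓ _ h _ (hsupp m)⟩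

lemma isConeOver_degreeComplex_srIdeal {Γ : FaceSet ι} (hΓ : IsSimplicialComplex Γ) {α : ι → ℤ}
    {v : ι} (hv : 0 < α v) : IsConeOver (degreeComplex K (srIdeal K Γ) α) v := by
  intro F hF
  rw [mem_degreeComplex_srIdeal hΓ] at hF ⊢
  refine ⟨fun i hi => ?_, ?_⟩
  · rcases Finset.mem_insert.1 hi with rfl | hi
    · exact hv.le
    · exact hF.1 i hi
  · rw [Finset.insert_union, Finset.union_insert, Finset.insert_eq_of_mem]
    · exact hF.2
    · simp [hv]

lemma degreeComplex_srIdeal_of_nonpos {Γ : FaceSet ι} (hΓ : IsSimplicialComplex Γ) {α : ι → ℤ}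
    (hα : ∀ i, α i ≤ 0) :
    degreeComplex K (srIdeal K Γ) α = linkOf Γ (negSupport α) := by
  ext F
  have hempty : (Finset.univ.filter fun i => 0 < α i) = ∅ :=
    Finset.filter_eq_empty_iff.2 fun i _ => (hα i).not_gt
  have hdisj : (∀ i ∈ F, 0 ≤ α i) ↔ Disjoint F (negSupport α) := by
    simp [Finset.disjoint_left, negSupport]
  rw [mem_degreeComplex_srIdeal hΓ, hempty, Finset.empty_union, hdisj]
  exact ⟨fun h => ⟨hΓ _ h.2 _ Finset.subset_union_left, h.2, h.1⟩, fun h => ⟨h.2.2, h.2.1⟩⟩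

end StanleyReisner

/-- Let `Δ` be a simplicial complex on `{1, …, r}` and
`simp(Δ) = {lk_Δ(σ) : σ ∈ Δ}`. Let `f` be an `ℕ`-valued function such that
(1) `f(Λ) = 0` whenever `Λ ∈ simp(Δ)` is a simplex, and (2) for every
`Λ ∈ simp(Δ)` and every vertex `v` of `Λ` such that `Λ` is not a cone over `v`,
`f(lk_Λ(v)) + 1 ≤ f(Λ)`. Then for every subcomplex `Γ` of `Δ` with
`F(Γ) ⊆ F(Δ)`, `reg(I_Γ) ≤ f(Δ) + 1`. -/
theorem statement10 {K : Type*} [Field K] {r : ℕ}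
    (Δ : FaceSet (Fin r)) (hΔ : IsSimplicialComplex Δ)
    (f : FaceSet (Fin r) → ℕ)
    (h1 : ∀ σ ∈ Δ, IsSimplexFaceSet (linkOf Δ σ) → f (linkOf Δ σ) = 0)
    (h2 : ∀ σ ∈ Δ, ∀ v ∈ verticesOf (linkOf Δ σ), ¬IsConeOver (linkOf Δ σ) v →
      f (linkOf (linkOf Δ σ) {v}) + 1 ≤ f (linkOf Δ σ))
    (Γ : FaceSet (Fin r)) (hΓ : IsSimplicialComplex Γ) (hΓΔ : Γ ⊆ Δ)
    (hfac : facets Γ ⊆ facets Δ) :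
    reg K (srIdeal K Γ) ≤ (f Δ : ℤ) + 1 := by
  refine add_le_add_left (?_ : regQuot K (srIdeal K Γ) ≤ f Δ) 1
  unfold regQuot
  rcases Set.eq_empty_or_nonempty
    {z : ℤ | ∃ (i : ℕ) (α : Fin r → ℤ), lcNonzero K (srIdeal K Γ) i α ∧ z = (∑ j, α j) + i}
    with hempty | hne
  · rw [hempty, Int.csSup_empty]
    exact Int.natCast_nonneg _
  refine csSup_le hne ?_
  rintro _ ⟨i, α, hlc, rfl⟩
  have hα : ∀ j, α j ≤ 0 := fun j => not_lt.1 fun hj =>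
    HasNontrivialReducedHomology.not_isConeOver hlc j (isConeOver_degreeComplex_srIdeal hΓ hj)
  rw [lcNonzero, degreeComplex_srIdeal_of_nonpos hΓ hα] at hlc
  obtain ⟨τ, hτ, hcard⟩ := hlc.exists_face
  have hi : (i : ℤ) - (negSupport α).card = τ.card := by omega
  rw [hi] at hlc
  have hle := HasNontrivialReducedHomology.le_of_isObstructionPreserving hΔ f h2
    (hΓ.linkOf (negSupport α)) (hΔ _ (hΓΔ hτ.1) ∅ (Finset.empty_subset τ))
    (by rw [linkOf_empty]; exact isObstructionPreserving_linkOf hΓ hΓΔ hfac _) hlc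
  rw [linkOf_empty] at hle
  have := sum_le_neg_card_negSupport hα
  omega
end
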